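/- (Combinatorial form of the general framework corollary.) There is a universal constant C > 0 such that the following holds for all integers n ≥ 2 and w ≥ 1. Let H ⊆ ℤ^n be a finite set with |H| ≥ 2 and ‖h‖_∞ ≤ w for all h ∈ H. Then for every x ∈ ℝ^n there exists a subset S ⊆ H with |S| ≤ C·n·log₂(n·w)·log₂|H| such that H ⊆ infer(S,x); that is, the sign pattern of x on S ∪ (S−S) determines sign⟨x,h⟩ for every h ∈ H. -/

import Mathlib

open Finset

namespace LDT

/-- The standard inner product on `ℝ^n`. -/
def ip {n : ℕ} (x h : Fin n → ℝ) : ℝ := ∑ i, x i * h i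

/-- `S` infers `h` at `x`: the sign of `⟨x,h⟩` is determined by the signs of `⟨x,v⟩` for
`v ∈ S ∪ (S - S)`, i.e. every `x'` with the same sign pattern as `x` on `S ∪ (S-S)` gives the
same sign on `h`. -/
def Infers {n : ℕ} (S : Finset (Fin n → ℝ)) (x h : Fin n → ℝ) : Prop :=
  ∀ x' : Fin n → ℝ,
    (∀ v ∈ S, SignType.sign (ip x' v) = SignType.sign (ip x v)) →
    (∀ v ∈ S, ∀ w ∈ S, SignType.sign (ip x' (v - w)) = SignType.sign (ip x (v - w))) →
    SignType.sign (ip x' h) = SignType.sign (ip x h)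

/-- `H` has inference dimension at most `d`: every subset `S ⊆ H` of size at least `d` contains,
for every `x`, an element `h` inferred by `S \ {h}` at `x`. -/
def InfProp {n : ℕ} (H : Finset (Fin n → ℝ)) (d : ℕ) : Prop :=
  ∀ S ⊆ H, d ≤ S.card → ∀ x : Fin n → ℝ, ∃ h ∈ S, Infers (S.erase h) x h

lemma ip_neg_left {n : ℕ} (x h : Fin n → ℝ) : ip (-x) h = -ip x h := by
  simp [ip]

lemma ip_add_right {n : ℕ} (x u v : Fin n → ℝ) : ip x (u + v) = ip x u + ip x v := by
  simp [ip, mul_add, sum_add_distrib]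

lemma ip_sub_right {n : ℕ} (x u v : Fin n → ℝ) : ip x (u - v) = ip x u - ip x v := by
  simp [ip, mul_sub, sum_sub_distrib]

lemma ip_smul_right {n : ℕ} (x v : Fin n → ℝ) (c : ℝ) : ip x (c • v) = c * ip x v := by
  simp [ip, mul_sum, mul_left_comm]

lemma ip_sum_right {n : ℕ} {ι : Type*} (x : Fin n → ℝ) (s : Finset ι) (v : ι → Fin n → ℝ) :
    ip x (∑ i ∈ s, v i) = ∑ i ∈ s, ip x (v i) := by
  simp only [ip, Finset.sum_apply, mul_sum]
  exact sum_comm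

lemma Infers.mono {n : ℕ} {S T : Finset (Fin n → ℝ)} {x h : Fin n → ℝ} (hST : S ⊆ T)
    (hS : Infers S x h) : Infers T x h := fun x' h₁ h₂ =>
  hS x' (fun v hv => h₁ v (hST hv)) (fun v hv u hu => h₂ v (hST hv) u (hST hu))

lemma infers_of_mem {n : ℕ} {S : Finset (Fin n → ℝ)} {x h : Fin n → ℝ} (hS : h ∈ S) :
    Infers S x h := fun _ h₁ _ => h₁ h hS

lemma infers_of_neg {n : ℕ} {S : Finset (Fin n → ℝ)} {x h : Fin n → ℝ}
    (hS : Infers S (-x) h) : Infers S x h := by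
  intro x' h₁ h₂
  have key := hS (-x') (fun v hv => ?_) (fun v hv u hu => ?_)
  · simpa [ip_neg_left, Left.sign_neg] using key
  · simp [ip_neg_left, Left.sign_neg, h₁ v hv]
  · simp [ip_neg_left, Left.sign_neg, h₂ v hv u hu]

lemma InfProp.subset {n d : ℕ} {H T : Finset (Fin n → ℝ)} (hH : InfProp H d) (hT : T ⊆ H) :
    InfProp T d := fun S hS => hH S (hS.trans hT)

lemma sign_add_eq_of_nonneg {a b a' b' : ℝ} (ha : 0 ≤ a) (hb : 0 ≤ b)
    (haa : SignType.sign a' = SignType.sign a) (hbb : SignType.sign b' = SignType.sign b) :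
    SignType.sign (a' + b') = SignType.sign (a + b) := by
  rcases ha.eq_or_lt with rfl | ha
  · rw [sign_zero, sign_eq_zero_iff] at haa
    simpa [haa] using hbb
  · rw [sign_pos ha, sign_eq_one_iff] at haa
    have hb' : 0 ≤ b' := by
      rw [← sign_nonneg_iff, hbb, sign_nonneg_iff]; exact hb
    rw [sign_pos (by linarith), sign_pos (by linarith)]

lemma sign_sum_eq_of_nonneg {ι : Type*} (s : Finset ι) (a a' : ι → ℝ) (ha : ∀ i ∈ s, 0 ≤ a i)
    (haa : ∀ i ∈ s, SignType.sign (a' i) = SignType.sign (a i)) :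
    SignType.sign (∑ i ∈ s, a' i) = SignType.sign (∑ i ∈ s, a i) := by
  classical
  induction s using Finset.induction_on with
  | empty => simp
  | insert i s hi ih =>
    rw [sum_insert hi, sum_insert hi]
    have ha' : ∀ j ∈ s, 0 ≤ a j := fun j hj => ha j (mem_insert_of_mem hj)
    exact sign_add_eq_of_nonneg (ha i (mem_insert_self _ _)) (sum_nonneg ha')
      (haa i (mem_insert_self _ _)) (ih ha' fun j hj => haa j (mem_insert_of_mem hj))

/-- Among sufficiently many bounded integer vectors, some vector is a combination of the previous
ones with coefficients in `{-1, 0, 1}`. -/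
lemma exists_eq_signed_sum {n b k : ℕ} (D : ℕ → Fin n → ℤ) (hD : ∀ i < k, ∀ j, |D i j| ≤ b)
    (hk : (2 * (k * b) + 1) ^ n < 2 ^ k) :
    ∃ p < k, ∃ α : ℕ → ℤ, (∀ i, -1 ≤ α i) ∧ D p = ∑ i ∈ range p, α i • D i := by
  classical
  obtain ⟨A, hA, B, hB, hAB, hsum⟩ : ∃ A ∈ (range k).powerset, ∃ B ∈ (range k).powerset,
      A ≠ B ∧ ∑ i ∈ A, D i = ∑ i ∈ B, D i := by
    refine exists_ne_map_eq_of_card_lt_of_maps_to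
      (t := Fintype.piFinset fun _ : Fin n => Icc (-((k * b : ℕ) : ℤ)) ((k * b : ℕ) : ℤ))
      ?_ ?_
    · simp only [Fintype.card_piFinset, prod_const, Int.card_Icc, card_univ, Fintype.card_fin,
        card_powerset, card_range]
      refine lt_of_eq_of_lt ?_ hk
      congr 1
      omega
    · intro A hA
      simp only [coe_powerset, Set.mem_preimage, Set.mem_powerset_iff, coe_subset] at hA
      simp only [mem_coe, Fintype.mem_piFinset, mem_Icc]
      intro j
      rw [← abs_le, Finset.sum_apply]
      calc |∑ i ∈ A, D i j| ≤ ∑ i ∈ A, |D i j| := abs_sum_le_sum_abs _ _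
        _ ≤ ∑ i ∈ A, (b : ℤ) := sum_le_sum fun i hi => hD i (mem_range.1 (hA hi)) j
        _ ≤ ∑ i ∈ range k, (b : ℤ) := sum_le_sum_of_subset_of_nonneg hA (by simp)
        _ = ((k * b : ℕ) : ℤ) := by simp
  rw [mem_powerset] at hA hB
  let e : Finset ℕ → ℕ → ℤ := fun U i => if i ∈ U then 1 else 0
  have he : ∀ U ⊆ range k, ∑ i ∈ U, D i = ∑ i ∈ range k, e U i • D i := by
    intro U hU
    simp only [e, ite_smul, one_smul, zero_smul, sum_ite_mem, inter_eq_right.2 hU]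
  have hzero : ∑ i ∈ range k, (e A i - e B i) • D i = 0 := by
    simp only [sub_smul, sum_sub_distrib]
    rw [← he A hA, ← he B hB, hsum, sub_self]
  have hne : (symmDiff A B).Nonempty := by
    rw [nonempty_iff_ne_empty]
    simpa using hAB
  obtain ⟨p, hp, hmax⟩ := exists_max_image (symmDiff A B) id hne
  have hpk : p < k := by
    rcases mem_symmDiff.1 hp with h | h
    exacts [mem_range.1 (hA h.1), mem_range.1 (hB h.1)]
  have hlt : ∀ i, p < i → e A i - e B i = 0 := by
    intro i hi
    have : i ∉ symmDiff A B := fun h => absurd (hmax i h) (by simpa using hi)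
    simp only [mem_symmDiff] at this
    simp only [e]
    by_cases h₁ : i ∈ A <;> by_cases h₂ : i ∈ B <;> simp_all
  have hzero' : ∑ i ∈ range p, (e A i - e B i) • D i + (e A p - e B p) • D p = 0 := by
    rw [← sum_range_succ, ← hzero]
    refine sum_subset (range_subset_range.2 hpk) fun i _ hi => ?_
    rw [hlt i (by simpa using hi), zero_smul]
  have hbound : ∀ U i, 0 ≤ e U i ∧ e U i ≤ 1 := by
    intro U i
    simp only [e]
    split_ifs <;> simp
  rcases mem_symmDiff.1 hp with h | h
  · refine ⟨p, hpk, fun i => -(e A i - e B i), fun i => ?_, ?_⟩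
    · linarith [(hbound A i).2, (hbound B i).1]
    · have h1 : e A p - e B p = 1 := by simp [e, h.1, h.2]
      rw [h1, one_smul] at hzero'
      simp only [neg_smul, sum_neg_distrib]
      exact eq_neg_of_add_eq_zero_right hzero'
  · refine ⟨p, hpk, fun i => e A i - e B i, fun i => ?_, ?_⟩
    · linarith [(hbound A i).1, (hbound B i).2]
    · have h1 : e A p - e B p = -1 := by simp [e, h.1, h.2]
      rw [h1, neg_one_smul] at hzero'
      exact (add_neg_eq_zero.1 hzero').symm

/-- The elements of a finite set can be listed in order of their values under a function. -/
lemma exists_enumeration_monotone {β : Type*} (S : Finset β) (φ : β → ℝ) :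
    ∃ f : Fin S.card → β, (∀ i, f i ∈ S) ∧ Function.Injective f ∧ Monotone (φ ∘ f) := by
  let e := S.equivFin.symm
  let σ := Tuple.sort fun i => φ (e i)
  exact ⟨fun i => e (σ i), fun i => (e (σ i)).2,
    Subtype.val_injective.comp (e.injective.comp σ.injective),
    Tuple.monotone_sort fun i => φ (e i)⟩

lemma exists_infers_erase_of_nonneg {n w k : ℕ} (S : Finset (Fin n → ℤ)) (x : Fin n → ℝ)
    (hS : ∀ h ∈ S, ∀ i, |h i| ≤ (w : ℤ))
    (hx : ∀ h ∈ S, 0 ≤ ip x (fun i => (h i : ℝ))) (hcard : k < S.card)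
    (hk : (2 * (k * (2 * w)) + 1) ^ n < 2 ^ k) :
    ∃ h ∈ S, Infers ((S.erase h).image fun h i => (h i : ℝ)) x (fun i => (h i : ℝ)) := by
  classical
  obtain ⟨f, hfS, hfinj, hfmono⟩ :=
    exists_enumeration_monotone S fun h => ip x (fun i => (h i : ℝ))
  let g : ℕ → Fin n → ℤ := fun i => if hi : i < S.card then f ⟨i, hi⟩ else 0
  have hg : ∀ i (hi : i < S.card), g i = f ⟨i, hi⟩ := fun i hi => dif_pos hi
  let G : ℕ → Fin n → ℝ := fun i j => (g i j : ℝ)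
  obtain ⟨p, hpk, α, hα, hp⟩ := exists_eq_signed_sum (b := 2 * w)
    (fun i => g (i + 1) - g i) (fun i hi j => by
      have h₁ := hS _ (hfS ⟨i, by omega⟩) j
      have h₂ := hS _ (hfS ⟨i + 1, by omega⟩) j
      rw [← hg] at h₁ h₂
      rw [abs_le] at h₁ h₂ ⊢
      simp only [Pi.sub_apply]
      push_cast
      constructor <;> linarith) hk
  have hG : G (p + 1) = G 0 + ∑ i ∈ range p, (1 + α i : ℝ) • (G (i + 1) - G i) := by
    have h₁ : G (p + 1) - G p = ∑ i ∈ range p, (α i : ℝ) • (G (i + 1) - G i) := by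
      ext j
      have := congrFun hp j
      simp only [Pi.sub_apply, Finset.sum_apply, Pi.smul_apply, smul_eq_mul] at this
      simp only [G, Pi.sub_apply, Finset.sum_apply, Pi.smul_apply, smul_eq_mul]
      exact_mod_cast this
    have h₂ : ∑ i ∈ range p, (G (i + 1) - G i) = G p - G 0 := sum_range_sub G p
    simp only [add_smul, one_smul, sum_add_distrib]
    rw [← h₁, h₂]
    abel
  have hip : ∀ y, ip y (G (p + 1)) =
      ip y (G 0) + ∑ i ∈ range p, (1 + α i : ℝ) * ip y (G (i + 1) - G i) := by
    intro y
    rw [hG, ip_add_right, ip_sum_right]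
    simp only [ip_smul_right]
  have hp1 : p + 1 < S.card := by omega
  have hmem : ∀ i ≤ p, G i ∈ (S.erase (g (p + 1))).image fun h i => (h i : ℝ) := by
    intro i hi
    refine mem_image_of_mem _ (mem_erase.2 ⟨?_, ?_⟩)
    · rw [hg i (by omega), hg _ hp1]
      intro h
      have := hfinj h
      simp only [Fin.mk.injEq] at this
      omega
    · rw [hg i (by omega)]
      exact hfS _
  refine ⟨g (p + 1), hg _ hp1 ▸ hfS _, fun x' h₁ h₂ => ?_⟩
  have hα' : ∀ i, (0 : ℝ) ≤ 1 + α i := by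
    intro i
    have : ((-1 : ℤ) : ℝ) ≤ α i := by exact_mod_cast hα i
    push_cast at this
    linarith
  have hdiff : ∀ i ∈ range p, 0 ≤ ip x (G (i + 1) - G i) := by
    intro i hi
    have hi := mem_range.1 hi
    rw [ip_sub_right, sub_nonneg]
    have := hfmono (a := ⟨i, by omega⟩) (b := ⟨i + 1, by omega⟩) (by simp)
    simpa only [Function.comp, ← hg, G] using this
  change SignType.sign (ip x' (G (p + 1))) = SignType.sign (ip x (G (p + 1)))
  rw [hip, hip]
  refine sign_add_eq_of_nonneg ?_ (sum_nonneg fun i hi => mul_nonneg (hα' i) (hdiff i hi))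
    (h₁ _ (hmem 0 (Nat.zero_le _))) (sign_sum_eq_of_nonneg _ _ _
      (fun i hi => mul_nonneg (hα' i) (hdiff i hi)) fun i hi => ?_)
  · have := hx _ (hfS ⟨0, by omega⟩)
    simpa only [← hg, G] using this
  · have hi := mem_range.1 hi
    rw [sign_mul, sign_mul, h₂ _ (hmem (i + 1) hi) _ (hmem i hi.le)]

lemma infProp_image_of_pow_lt {n w k : ℕ} (H : Finset (Fin n → ℤ))
    (hH : ∀ h ∈ H, ∀ i, |h i| ≤ (w : ℤ)) (hk : (2 * (k * (2 * w)) + 1) ^ n < 2 ^ k) :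
    InfProp (H.image fun h i => (h i : ℝ)) (2 * k + 1) := by
  classical
  intro S hSH hcard x
  obtain ⟨T, hTH, rfl⟩ := subset_image_iff.1 hSH
  have hcardT : 2 * k + 1 ≤ T.card := hcard.trans card_image_le
  have hinj : Function.Injective fun (h : Fin n → ℤ) i => (h i : ℝ) := by
    intro a b hab
    ext i
    exact Int.cast_injective (congrFun hab i)
  have herase : ∀ (U : Finset (Fin n → ℤ)) (h : Fin n → ℤ), U ⊆ T →
      ((U.erase h).image fun h i => (h i : ℝ)) ⊆
        (T.image fun h i => (h i : ℝ)).erase fun i => (h i : ℝ) := by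
    intro U h hU
    rw [image_erase hinj]
    exact erase_subset_erase _ (image_subset_image hU)
  let P := T.filter fun h => 0 ≤ ip x (fun i => (h i : ℝ))
  let N := T.filter fun h => ¬ 0 ≤ ip x (fun i => (h i : ℝ))
  have hPN : P.card + N.card = T.card := card_filter_add_card_filter_not _
  have hbound : ∀ h ∈ T, ∀ i, |h i| ≤ (w : ℤ) := fun h hh => hH h (hTH hh)
  have hPT : P ⊆ T := filter_subset _ _
  have hNT : N ⊆ T := filter_subset _ _
  rcases lt_or_ge k P.card with hP | hP
  · obtain ⟨h, hh, hinf⟩ := exists_infers_erase_of_nonneg P x (fun h hh => hbound h (hPT hh))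
      (fun h hh => (mem_filter.1 hh).2) hP hk
    exact ⟨_, mem_image_of_mem _ (hPT hh), hinf.mono (herase P h hPT)⟩
  · obtain ⟨h, hh, hinf⟩ := exists_infers_erase_of_nonneg N (-x) (fun h hh => hbound h (hNT hh))
      (fun h hh => by
        have := (mem_filter.1 hh).2
        rw [ip_neg_left]
        linarith) (by omega : k < N.card) hk
    exact ⟨_, mem_image_of_mem _ (hNT hh), (infers_of_neg hinf).mono (herase N h hNT)⟩

open Classical in
/-- Averaging over subsets: some small subset infers at least half of the vectors. -/
lemma InfProp.exists_subset_card_not_infers_le {n d : ℕ} {T : Finset (Fin n → ℝ)}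
    (hT : InfProp T d) (hd : 1 ≤ d) (x : Fin n → ℝ) :
    ∃ R ⊆ T, R.card ≤ 2 * d ∧ 2 * (T.filter fun h => ¬ Infers R x h).card ≤ T.card := by
  by_cases hcard : T.card ≤ 2 * d
  · refine ⟨T, Subset.rfl, hcard, ?_⟩
    rw [filter_false_of_mem fun h hh => not_not.2 (infers_of_mem hh)]
    simp
  by_contra! hcon
  obtain ⟨q, rfl⟩ : ∃ q, d = q + 1 := ⟨d - 1, by omega⟩
  let r : Finset (Fin n → ℝ) → Finset (Fin n → ℝ) → Prop := fun R U =>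
    ∃ h ∈ U, R = U.erase h ∧ ¬ Infers R x h
  have hcount := card_mul_le_card_mul r (s := T.powersetCard (2 * q + 1))
    (t := T.powersetCard (2 * q + 2)) (m := T.card / 2 + 1) (n := q) ?_ ?_
  · rw [card_powersetCard, card_powersetCard] at hcount
    have hch := Nat.choose_succ_right_eq T.card (2 * q + 1)
    have hpos : 0 < T.card.choose (2 * q + 1) := Nat.choose_pos (by omega)
    have h₁ : T.card.choose (2 * q + 1) * ((T.card / 2 + 1) * (2 * q + 2)) ≤
        T.card.choose (2 * q + 1) * ((T.card - (2 * q + 1)) * q) := by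
      calc _ = T.card.choose (2 * q + 1) * (T.card / 2 + 1) * (2 * q + 2) := by ring
        _ ≤ T.card.choose (2 * q + 2) * q * (2 * q + 2) := Nat.mul_le_mul_right _ hcount
        _ = T.card.choose (2 * q + 1 + 1) * (2 * q + 1 + 1) * q := by ring
        _ = _ := by rw [hch]; ring
    have h₂ := Nat.le_of_mul_le_mul_left h₁ hpos
    have h₃ : T.card - (2 * q + 1) ≤ 2 * (T.card / 2 + 1) := by omega
    have h₄ := Nat.mul_le_mul_right q h₃
    have h₅ := h₂.trans h₄
    generalize T.card / 2 = a at h₅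
    nlinarith
  · intro R hR
    rw [mem_powersetCard] at hR
    refine le_trans (b := (T.filter fun h => ¬ Infers R x h).card) ?_ ?_
    · have := hcon R hR.1 (by omega)
      omega
    · refine card_le_card_of_injOn (fun h => insert h R) ?_ ?_
      · intro h hh
        rw [mem_coe, mem_filter] at hh
        have hhR : h ∉ R := fun hm => hh.2 (infers_of_mem hm)
        rw [mem_coe, mem_bipartiteAbove, mem_powersetCard, card_insert_of_notMem hhR]
        exact ⟨⟨insert_subset hh.1 hR.1, by omega⟩, h, mem_insert_self _ _,
          (erase_insert hhR).symm, hh.2⟩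
      · intro a ha b hb hab
        rw [mem_coe, mem_filter] at ha hb
        have haR : a ∉ R := fun hm => ha.2 (infers_of_mem hm)
        have : a ∈ insert b R := by
          have hab' : insert a R = insert b R := hab
          exact hab' ▸ mem_insert_self a R
        exact (mem_insert.1 this).resolve_right haR
  · intro U hU
    rw [mem_powersetCard] at hU
    let V := U.filter fun h => ¬ Infers (U.erase h) x h
    have hV : V.card ≤ q := by
      by_contra! hVq
      obtain ⟨h, hh, hinf⟩ := hT V ((filter_subset _ _).trans hU.1) hVq x
      exact (mem_filter.1 hh).2 (hinf.mono (erase_subset_erase _ (filter_subset _ _)))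
    refine le_trans (card_le_card ?_) (card_image_le (s := V) (f := fun h => U.erase h) |>.trans hV)
    intro R hR
    rw [mem_bipartiteBelow] at hR
    obtain ⟨-, h, hh, rfl, hinf⟩ := hR
    exact mem_image_of_mem _ (mem_filter.2 ⟨hh, hinf⟩)

lemma InfProp.exists_subset_infers {n d : ℕ} (hd : 1 ≤ d) (x : Fin n → ℝ) (j : ℕ)
    {T : Finset (Fin n → ℝ)} (hT : InfProp T d) (hj : T.card < 2 ^ j) :
    ∃ S ⊆ T, S.card ≤ 2 * d * j ∧ ∀ h ∈ T, Infers S x h := by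
  classical
  induction j generalizing T with
  | zero =>
    refine ⟨∅, empty_subset _, by simp, fun h hh => ?_⟩
    have := card_pos.2 ⟨h, hh⟩
    omega
  | succ j ih =>
    obtain ⟨R, hRT, hR, hhalf⟩ := hT.exists_subset_card_not_infers_le hd x
    have hsub : (T.filter fun h => ¬ Infers R x h) ⊆ T := filter_subset _ _
    obtain ⟨S, hS, hScard, hSinf⟩ := ih (hT.subset hsub) (by rw [pow_succ] at hj; omega)
    refine ⟨R ∪ S, union_subset hRT (hS.trans hsub), ?_, fun h hh => ?_⟩
    · have := card_union_le R S
      rw [mul_add, mul_one]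
      omega
    · by_cases hinf : Infers R x h
      · exact hinf.mono subset_union_left
      · exact (hSinf h (mem_filter.2 ⟨hh, hinf⟩)).mono subset_union_right

lemma pow_lt_two_pow_mul_log {n w : ℕ} (hn : 2 ≤ n) (hw : 1 ≤ w) :
    (2 * (15 * n * Nat.log 2 (n * w) * (2 * w)) + 1) ^ n <
      2 ^ (15 * n * Nat.log 2 (n * w)) := by
  set L := Nat.log 2 (n * w)
  have hnw : 2 ≤ n * w := by nlinarith
  have hL : 1 ≤ L := Nat.log_pos one_lt_two hnw
  have hlt : n * w < 2 ^ (L + 1) := Nat.lt_pow_succ_log_self one_lt_two _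
  have hL2 : L < 2 ^ L := Nat.lt_two_pow_self
  have h1 : n * w * L ≤ 2 ^ (L + 1) * 2 ^ L := Nat.mul_le_mul hlt.le hL2.le
  have hbase : 2 * (15 * n * L * (2 * w)) + 1 < 2 ^ (15 * L) := by
    calc 2 * (15 * n * L * (2 * w)) + 1 = 60 * (n * w * L) + 1 := by ring
      _ ≤ 60 * (2 ^ (L + 1) * 2 ^ L) + 1 := by omega
      _ < 64 * (2 ^ (L + 1) * 2 ^ L) := by
        have : 0 < 2 ^ (L + 1) * 2 ^ L := by positivity
        omega
      _ = 2 ^ (6 + (L + 1) + L) := by rw [pow_add _ _ L, pow_add 2 6]; ring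
      _ ≤ 2 ^ (15 * L) := Nat.pow_le_pow_right two_pos (by omega)
  calc _ < (2 ^ (15 * L)) ^ n := Nat.pow_lt_pow_left hbase (by omega)
    _ = 2 ^ (15 * n * L) := by rw [← pow_mul]; ring_nf

/-- Corollary 1.9, combinatorial form: there is a universal constant `C > 0`
such that for all `n ≥ 2`, `w ≥ 1`, any finite `H ⊆ ℤ^n` with `|H| ≥ 2` and `‖h‖_∞ ≤ w` for
all `h ∈ H`, and any `x ∈ ℝ^n`, there is a subset `S ⊆ H` (viewing `H` inside `ℝ^n`) of size
at most `C·n·log₂(n·w)·log₂|H|` whose sign pattern at `x` determines `sign⟨x,h⟩` for all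
`h ∈ H`. -/
theorem general_framework_combinatorial :
    ∃ C : ℝ, 0 < C ∧ ∀ (n w : ℕ) (H : Finset (Fin n → ℤ)),
      2 ≤ n → 1 ≤ w → 2 ≤ H.card → (∀ h ∈ H, ∀ i, |h i| ≤ (w : ℤ)) →
      ∀ x : Fin n → ℝ,
        ∃ S ⊆ H.image (fun h i => ((h i : ℤ) : ℝ)),
          ((S.card : ℝ) ≤ C * n * Real.logb 2 (n * w) * Real.logb 2 H.card) ∧
          ∀ h ∈ H.image (fun h i => ((h i : ℤ) : ℝ)), Infers S x h := by
  refine ⟨128, by norm_num, fun n w H hn hw hcard hH x => ?_⟩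
  have hinf := infProp_image_of_pow_lt H hH (pow_lt_two_pow_mul_log hn hw)
  obtain ⟨S, hSH, hS, hall⟩ := hinf.exists_subset_infers (by omega) x (Nat.log 2 H.card + 1)
    (card_image_le.trans_lt (Nat.lt_pow_succ_log_self one_lt_two _))
  refine ⟨S, hSH, ?_, hall⟩
  have hnw : 2 ≤ n * w := by nlinarith
  have hL : 1 ≤ Nat.log 2 (n * w) := Nat.log_pos one_lt_two hnw
  have hM : 1 ≤ Nat.log 2 H.card := Nat.log_pos one_lt_two hcard
  have hLr : (Nat.log 2 (n * w) : ℝ) ≤ Real.logb 2 (n * w) := by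
    exact_mod_cast Real.natLog_le_logb (n * w) 2
  have hMr : (Nat.log 2 H.card : ℝ) ≤ Real.logb 2 H.card := by
    exact_mod_cast Real.natLog_le_logb H.card 2
  have hnL : 1 ≤ n * Nat.log 2 (n * w) := Nat.mul_pos (by omega) hL
  have hSnat : S.card ≤ 128 * n * Nat.log 2 (n * w) * Nat.log 2 H.card := by
    calc S.card ≤ 2 * (2 * (15 * n * Nat.log 2 (n * w)) + 1) * (Nat.log 2 H.card + 1) := hS
      _ ≤ (64 * (n * Nat.log 2 (n * w))) * (2 * Nat.log 2 H.card) :=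
        Nat.mul_le_mul (by linarith) (by omega)
      _ = _ := by ring
  calc (S.card : ℝ) ≤ 128 * n * Nat.log 2 (n * w) * Nat.log 2 H.card := by exact_mod_cast hSnat
    _ ≤ 128 * n * Real.logb 2 (n * w) * Real.logb 2 H.card := by
      have : (0 : ℝ) ≤ Real.logb 2 (n * w) := le_trans (Nat.cast_nonneg _) hLr
      gcongr

end LDT
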